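/- Let ξ_x, ξ_y be nonnegative integers with ξ_x + ξ_y ≥ 3 and write D(x,y) = ∂^{ξ_x+ξ_y} BS_Put / ∂x^{ξ_x} ∂y^{ξ_y} (x,y). Then: (i) for every fixed y > 0, D(x,y) → 0 as x → 0⁺ and as x → ∞; (ii) for every fixed x > 0, D(x,y) → 0 as y → ∞; and (iii) for every fixed x > 0 with ln(x/K) + rT ≠ 0, D(x,y) → 0 as y → 0⁺. -/

import Mathlib

/-- Density of the standard normal distribution. -/
noncomputable def stdGaussianPDF (z : ℝ) : ℝ :=
  (Real.sqrt (2 * Real.pi))⁻¹ * Real.exp (-z ^ 2 / 2)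

/-- Cumulative distribution function of the standard normal distribution. -/
noncomputable def stdGaussianCDF (z : ℝ) : ℝ :=
  ∫ t in Set.Iic z, stdGaussianPDF t

/-- d₊ from the Black–Scholes formula. -/
noncomputable def dPlus (K r T x y : ℝ) : ℝ :=
  (Real.log (x / K) + r * T + y / 2) / Real.sqrt y

/-- d₋ from the Black–Scholes formula. -/
noncomputable def dMinus (K r T x y : ℝ) : ℝ :=
  (Real.log (x / K) + r * T - y / 2) / Real.sqrt y

/-- Black–Scholes put price with strike `K`, interest rate `r`, maturity `T`,
spot `x` and integrated variance `y`. -/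
noncomputable def BSPut (K r T x y : ℝ) : ℝ :=
  K * Real.exp (-(r * T)) * stdGaussianCDF (-(dMinus K r T x y)) -
    x * stdGaussianCDF (-(dPlus K r T x y))

/-- Mixed partial derivative: `nx` derivatives in the first variable and
`ny` derivatives in the second variable. -/
noncomputable def mixedPartial (f : ℝ → ℝ → ℝ) (nx ny : ℕ) (x y : ℝ) : ℝ :=
  iteratedDeriv nx (fun x' => iteratedDeriv ny (fun y' => f x' y') y) x

open Filter Topology in
theorem hasDerivAt_stdGaussianCDF (z : ℝ) :
    HasDerivAt stdGaussianCDF (stdGaussianPDF z) z := by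
  have hcont : Continuous stdGaussianPDF := by unfold stdGaussianPDF; fun_prop
  have hint : MeasureTheory.Integrable stdGaussianPDF := by
    unfold stdGaussianPDF
    refine ((integrable_exp_neg_mul_sq (b := 1 / 2) (by norm_num)).const_mul (√(2 * Real.pi))⁻¹).congr
      (Eventually.of_forall fun t => ?_)
    ring_nf
  have heq : stdGaussianCDF = fun w => stdGaussianCDF z + ∫ t in z..w, stdGaussianPDF t := by
    funext w
    rw [← intervalIntegral.integral_Iic_sub_Iic hint.integrableOn hint.integrableOn]
    simp only [stdGaussianCDF]
    ring
  rw [heq]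
  exact (hcont.integral_hasStrictDerivAt z z).hasDerivAt.const_add _

theorem stdGaussianPDF_neg (z : ℝ) : stdGaussianPDF (-z) = stdGaussianPDF z := by
  simp [stdGaussianPDF]

theorem dPlus_eq_dMinus_add_sqrt (K r T x : ℝ) {y : ℝ} (hy : 0 < y) :
    dPlus K r T x y = dMinus K r T x y + √y := by
  have h := Real.sq_sqrt hy.le
  have hs : √y ≠ 0 := (Real.sqrt_pos.2 hy).ne'
  unfold dPlus dMinus
  field_simp
  rw [h]
  ring

/-- The identity `K e^{-rT} φ(d₋) = x φ(d₊)`. -/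
theorem strike_mul_pdf_dMinus (r T : ℝ) {K x y : ℝ} (hK : 0 < K) (hx : 0 < x) (hy : 0 < y) :
    K * Real.exp (-(r * T)) * stdGaussianPDF (dMinus K r T x y) =
      x * stdGaussianPDF (dPlus K r T x y) := by
  have h := Real.sq_sqrt hy.le
  have hexp : -dMinus K r T x y ^ 2 / 2 =
      -dPlus K r T x y ^ 2 / 2 + (Real.log (x / K) + r * T) := by
    unfold dPlus dMinus
    rw [div_pow, div_pow, h]
    field_simp
    ring
  simp only [stdGaussianPDF]
  rw [hexp, Real.exp_add, Real.exp_add, Real.exp_log (by positivity), Real.exp_neg]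
  field_simp

/-- The building blocks `Lⁱ xᵃ yᵇ exp(-d₊² / 2)` of the derivatives of the put price, where
`L = ln (x / K) + r T`. -/
noncomputable def bsMonomial (K r T : ℝ) (i : ℕ) (a b : ℝ) (x y : ℝ) : ℝ :=
  (Real.log (x / K) + r * T) ^ i * x ^ a * y ^ b *
    Real.exp (-(Real.log (x / K) + r * T) ^ 2 / (2 * y) - (Real.log (x / K) + r * T) / 2 - y / 8)

/-- The linear span of the functions `bsMonomial K r T i a b`. -/
noncomputable def bsSpan (K r T : ℝ) : Submodule ℝ (ℝ → ℝ → ℝ) :=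
  Submodule.span ℝ {f | ∃ (i : ℕ) (a b : ℝ), f = bsMonomial K r T i a b}

theorem bsMonomial_mem_bsSpan (K r T : ℝ) (i : ℕ) (a b : ℝ) :
    bsMonomial K r T i a b ∈ bsSpan K r T :=
  Submodule.subset_span ⟨i, a, b, rfl⟩

theorem pdf_dPlus_eq (K r T x : ℝ) {y : ℝ} (hy : 0 < y) :
    stdGaussianPDF (dPlus K r T x y) = (√(2 * Real.pi))⁻¹ *
      Real.exp (-(Real.log (x / K) + r * T) ^ 2 / (2 * y) -
        (Real.log (x / K) + r * T) / 2 - y / 8) := by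
  have h := Real.sq_sqrt hy.le
  unfold stdGaussianPDF dPlus
  rw [div_pow, h]
  congr 2
  field_simp
  ring

theorem hasDerivAt_log_div_add (r T : ℝ) {K x : ℝ} (hK : 0 < K) (hx : 0 < x) :
    HasDerivAt (fun x => Real.log (x / K) + r * T) x⁻¹ x := by
  have := (((hasDerivAt_id x).div_const K).log (by simp [hx.ne', hK.ne'])).add_const (r * T)
  refine this.congr_deriv ?_
  simp only [id]
  field_simp

theorem exists_hasDerivAt_fst_mem_bsSpan {K r T : ℝ} (hK : 0 < K) {f : ℝ → ℝ → ℝ}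
    (hf : f ∈ bsSpan K r T) :
    ∃ g ∈ bsSpan K r T, ∀ x y, 0 < x → 0 < y → HasDerivAt (fun x => f x y) (g x y) x := by
  induction hf using Submodule.span_induction with
  | mem f hf =>
    obtain ⟨i, a, b, rfl⟩ := hf
    refine ⟨(i : ℝ) • bsMonomial K r T (i - 1) (a - 1) b + a • bsMonomial K r T i (a - 1) b -
      bsMonomial K r T (i + 1) (a - 1) (b - 1) - (1 / 2 : ℝ) • bsMonomial K r T i (a - 1) b,
      ?_, fun x y hx hy => ?_⟩
    · exact sub_mem (sub_mem (add_mem (Submodule.smul_mem _ _ (bsMonomial_mem_bsSpan K r T _ _ _))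
        (Submodule.smul_mem _ _ (bsMonomial_mem_bsSpan K r T _ _ _))) (bsMonomial_mem_bsSpan K r T _ _ _))
        (Submodule.smul_mem _ _ (bsMonomial_mem_bsSpan K r T _ _ _))
    · have hL := hasDerivAt_log_div_add r T hK hx
      have h := (((hL.fun_pow i).fun_mul
        (Real.hasDerivAt_rpow_const (p := a) (Or.inl hx.ne'))).mul_const (y ^ b)).fun_mul
        ((((hL.fun_pow 2).fun_neg.div_const (2 * y)).fun_sub (hL.div_const 2)).sub_const (y / 8)).exp
      refine h.congr_deriv ?_
      simp only [bsMonomial, Pi.add_apply, Pi.sub_apply, Pi.smul_apply, smul_eq_mul,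
        Real.rpow_sub hx, Real.rpow_sub hy, Real.rpow_one]
      field_simp
      ring
  | zero => exact ⟨0, zero_mem _, fun x y _ _ => hasDerivAt_const x 0⟩
  | add f₁ f₂ _ _ h₁ h₂ =>
    obtain ⟨g₁, hg₁, h₁⟩ := h₁
    obtain ⟨g₂, hg₂, h₂⟩ := h₂
    exact ⟨g₁ + g₂, add_mem hg₁ hg₂, fun x y hx hy => (h₁ x y hx hy).add (h₂ x y hx hy)⟩
  | smul c f _ h =>
    obtain ⟨g, hg, h⟩ := h
    exact ⟨c • g, Submodule.smul_mem _ _ hg, fun x y hx hy => (h x y hx hy).const_mul c⟩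

theorem exists_hasDerivAt_snd_mem_bsSpan {K r T : ℝ} {f : ℝ → ℝ → ℝ}
    (hf : f ∈ bsSpan K r T) :
    ∃ g ∈ bsSpan K r T, ∀ x y, 0 < x → 0 < y → HasDerivAt (f x) (g x y) y := by
  induction hf using Submodule.span_induction with
  | mem f hf =>
    obtain ⟨i, a, b, rfl⟩ := hf
    refine ⟨b • bsMonomial K r T i a (b - 1) + (1 / 2 : ℝ) • bsMonomial K r T (i + 2) a (b - 2) -
      (1 / 8 : ℝ) • bsMonomial K r T i a b, ?_, fun x y hx hy => ?_⟩
    · exact sub_mem (add_mem (Submodule.smul_mem _ _ (bsMonomial_mem_bsSpan K r T _ _ _))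
        (Submodule.smul_mem _ _ (bsMonomial_mem_bsSpan K r T _ _ _)))
        (Submodule.smul_mem _ _ (bsMonomial_mem_bsSpan K r T _ _ _))
    · set L := Real.log (x / K) + r * T with hL
      have h := ((Real.hasDerivAt_rpow_const (p := b) (Or.inl hy.ne')).const_mul
        (L ^ i * x ^ a)).fun_mul
        ((((((hasDerivAt_id y).const_mul 2).fun_inv (by simp [hy.ne'])).const_mul (-L ^ 2)).sub_const
          (L / 2)).fun_sub ((hasDerivAt_id y).div_const 8)).exp
      refine h.congr_deriv ?_
      simp only [bsMonomial, ← hL, Pi.add_apply, Pi.sub_apply, Pi.smul_apply, smul_eq_mul,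
        Real.rpow_sub hy, Real.rpow_one, Real.rpow_two, id, div_eq_mul_inv (-L ^ 2)]
      field_simp
      ring
  | zero => exact ⟨0, zero_mem _, fun x y _ _ => hasDerivAt_const y 0⟩
  | add f₁ f₂ _ _ h₁ h₂ =>
    obtain ⟨g₁, hg₁, h₁⟩ := h₁
    obtain ⟨g₂, hg₂, h₂⟩ := h₂
    exact ⟨g₁ + g₂, add_mem hg₁ hg₂, fun x y hx hy => (h₁ x y hx hy).add (h₂ x y hx hy)⟩
  | smul c f _ h =>
    obtain ⟨g, hg, h⟩ := h
    exact ⟨c • g, Submodule.smul_mem _ _ hg, fun x y hx hy => (h x y hx hy).const_mul c⟩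

theorem exists_iteratedDeriv_fst_mem_bsSpan {K r T : ℝ} (hK : 0 < K) {f : ℝ → ℝ → ℝ}
    (hf : f ∈ bsSpan K r T) (n : ℕ) :
    ∃ g ∈ bsSpan K r T, ∀ x y, 0 < x → 0 < y → iteratedDeriv n (fun x => f x y) x = g x y := by
  induction n with
  | zero => exact ⟨f, hf, fun x y _ _ => by simp⟩
  | succ n ih =>
    obtain ⟨g, hg, h⟩ := ih
    obtain ⟨g', hg', h'⟩ := exists_hasDerivAt_fst_mem_bsSpan hK hg
    refine ⟨g', hg', fun x y hx hy => ?_⟩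
    rw [iteratedDeriv_succ, ← (h' x y hx hy).deriv]
    refine Filter.EventuallyEq.deriv_eq ?_
    filter_upwards [lt_mem_nhds hx] with z hz using h z y hz hy

theorem exists_iteratedDeriv_snd_mem_bsSpan {K r T : ℝ} {f : ℝ → ℝ → ℝ}
    (hf : f ∈ bsSpan K r T) (n : ℕ) :
    ∃ g ∈ bsSpan K r T, ∀ x y, 0 < x → 0 < y → iteratedDeriv n (f x) y = g x y := by
  induction n with
  | zero => exact ⟨f, hf, fun x y _ _ => by simp⟩
  | succ n ih =>
    obtain ⟨g, hg, h⟩ := ih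
    obtain ⟨g', hg', h'⟩ := exists_hasDerivAt_snd_mem_bsSpan hg
    refine ⟨g', hg', fun x y hx hy => ?_⟩
    rw [iteratedDeriv_succ, ← (h' x y hx hy).deriv]
    refine Filter.EventuallyEq.deriv_eq ?_
    filter_upwards [lt_mem_nhds hy] with z hz using h x z hx hz

theorem hasDerivAt_BSPut_snd (r T : ℝ) {K x y : ℝ} (hK : 0 < K) (hx : 0 < x) (hy : 0 < y) :
    HasDerivAt (BSPut K r T x) (x * stdGaussianPDF (dPlus K r T x y) / (2 * √y)) y := by
  have hs : √y ≠ 0 := (Real.sqrt_pos.2 hy).ne'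
  have hsqrt := Real.hasDerivAt_sqrt hy.ne'
  obtain ⟨m, hm⟩ : ∃ m, HasDerivAt (dMinus K r T x) m y :=
    ⟨_, (((hasDerivAt_id y).div_const 2).const_sub (Real.log (x / K) + r * T)).fun_div hsqrt hs⟩
  have hp : HasDerivAt (dPlus K r T x) (m + 1 / (2 * √y)) y := by
    refine (hm.fun_add hsqrt).congr_of_eventuallyEq ?_
    filter_upwards [lt_mem_nhds hy] with z hz using dPlus_eq_dMinus_add_sqrt K r T x hz
  have h := (((hasDerivAt_stdGaussianCDF _).comp y hm.fun_neg).const_mul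
    (K * Real.exp (-(r * T)))).fun_sub
    (((hasDerivAt_stdGaussianCDF _).comp y hp.fun_neg).const_mul x)
  refine h.congr_deriv ?_
  rw [stdGaussianPDF_neg, stdGaussianPDF_neg]
  linear_combination (-m) * strike_mul_pdf_dMinus r T hK hx hy

theorem hasDerivAt_dPlus_fst (r T : ℝ) {K x : ℝ} (y : ℝ) (hK : 0 < K) (hx : 0 < x) :
    HasDerivAt (fun x => dPlus K r T x y) (x⁻¹ / √y) x :=
  ((hasDerivAt_log_div_add r T hK hx).add_const (y / 2)).div_const (√y)

theorem hasDerivAt_dMinus_fst (r T : ℝ) {K x : ℝ} (y : ℝ) (hK : 0 < K) (hx : 0 < x) :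
    HasDerivAt (fun x => dMinus K r T x y) (x⁻¹ / √y) x :=
  ((hasDerivAt_log_div_add r T hK hx).sub_const (y / 2)).div_const (√y)

theorem hasDerivAt_BSPut_fst (r T : ℝ) {K x y : ℝ} (hK : 0 < K) (hx : 0 < x) (hy : 0 < y) :
    HasDerivAt (fun x => BSPut K r T x y) (-stdGaussianCDF (-dPlus K r T x y)) x := by
  have h := (((hasDerivAt_stdGaussianCDF _).comp x
    (hasDerivAt_dMinus_fst r T y hK hx).fun_neg).const_mul (K * Real.exp (-(r * T)))).fun_sub
    ((hasDerivAt_id x).fun_mul ((hasDerivAt_stdGaussianCDF _).comp x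
      (hasDerivAt_dPlus_fst r T y hK hx).fun_neg))
  refine h.congr_deriv ?_
  simp only [stdGaussianPDF_neg, id, Function.comp]
  linear_combination (-(x⁻¹ / √y)) * strike_mul_pdf_dMinus r T hK hx hy

theorem exists_deriv_BSPut_snd_mem_bsSpan (r T : ℝ) {K : ℝ} (hK : 0 < K) :
    ∃ g ∈ bsSpan K r T, ∀ x y, 0 < x → 0 < y → deriv (BSPut K r T x) y = g x y := by
  refine ⟨((√(2 * Real.pi))⁻¹ / 2) • bsMonomial K r T 0 1 (-(1 / 2)),
    Submodule.smul_mem _ _ (bsMonomial_mem_bsSpan K r T _ _ _), fun x y hx hy => ?_⟩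
  rw [(hasDerivAt_BSPut_snd r T hK hx hy).deriv, pdf_dPlus_eq K r T x hy]
  simp only [bsMonomial, Pi.smul_apply, smul_eq_mul, Real.rpow_one, Real.rpow_neg hy.le,
    ← Real.sqrt_eq_rpow]
  field_simp

theorem exists_deriv_deriv_BSPut_fst_mem_bsSpan (r T : ℝ) {K : ℝ} (hK : 0 < K) :
    ∃ g ∈ bsSpan K r T, ∀ x y, 0 < x → 0 < y →
      deriv (deriv fun x => BSPut K r T x y) x = g x y := by
  refine ⟨(√(2 * Real.pi))⁻¹ • bsMonomial K r T 0 (-1) (-(1 / 2)),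
    Submodule.smul_mem _ _ (bsMonomial_mem_bsSpan K r T _ _ _), fun x y hx hy => ?_⟩
  have heq : deriv (fun x => BSPut K r T x y) =ᶠ[nhds x]
      fun x => -stdGaussianCDF (-dPlus K r T x y) := by
    filter_upwards [lt_mem_nhds hx] with z hz using (hasDerivAt_BSPut_fst r T hK hz hy).deriv
  have h := ((hasDerivAt_stdGaussianCDF _).comp x
      (hasDerivAt_dPlus_fst r T y hK hx).fun_neg).fun_neg
  rw [heq.deriv_eq]
  refine h.deriv.trans ?_
  rw [stdGaussianPDF_neg, pdf_dPlus_eq K r T x hy]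
  simp only [bsMonomial, Pi.smul_apply, smul_eq_mul, Real.rpow_neg_one, Real.rpow_neg hy.le,
    ← Real.sqrt_eq_rpow]
  field_simp

theorem exists_mixedPartial_BSPut_mem_bsSpan (r T : ℝ) {K : ℝ} (hK : 0 < K) (n m : ℕ)
    (hnm : 2 ≤ n ∨ 1 ≤ m) :
    ∃ g ∈ bsSpan K r T, ∀ x y, 0 < x → 0 < y → mixedPartial (BSPut K r T) n m x y = g x y := by
  rcases m with _ | m
  · obtain ⟨n, rfl⟩ : ∃ k, n = k + 2 := ⟨n - 2, by omega⟩
    obtain ⟨g, hg, h⟩ := exists_deriv_deriv_BSPut_fst_mem_bsSpan r T hK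
    obtain ⟨g', hg', h'⟩ := exists_iteratedDeriv_fst_mem_bsSpan hK hg n
    refine ⟨g', hg', fun x y hx hy => ?_⟩
    simp only [mixedPartial, iteratedDeriv_zero]
    rw [iteratedDeriv_succ', iteratedDeriv_succ', ← h' x y hx hy]
    refine Filter.EventuallyEq.iteratedDeriv_eq n ?_
    filter_upwards [lt_mem_nhds hx] with z hz using h z y hz hy
  · obtain ⟨g, hg, h⟩ := exists_deriv_BSPut_snd_mem_bsSpan r T hK
    obtain ⟨g', hg', h'⟩ := exists_iteratedDeriv_snd_mem_bsSpan hg m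
    obtain ⟨g'', hg'', h''⟩ := exists_iteratedDeriv_fst_mem_bsSpan hK hg' n
    refine ⟨g'', hg'', fun x y hx hy => ?_⟩
    rw [← h'' x y hx hy]
    refine Filter.EventuallyEq.iteratedDeriv_eq n ?_
    filter_upwards [lt_mem_nhds hx] with z hz
    rw [iteratedDeriv_succ', ← h' z y hz hy]
    refine Filter.EventuallyEq.iteratedDeriv_eq m ?_
    filter_upwards [lt_mem_nhds hy] with w hw using h z w hz hw

open Filter Topology in
theorem tendsto_pow_mul_exp_sub_sq_cocompact (i : ℕ) (b : ℝ) {c : ℝ} (hc : 0 < c) :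
    Tendsto (fun t : ℝ => t ^ i * Real.exp (b * t - c * t ^ 2)) (cocompact ℝ) (𝓝 0) := by
  have h := (tendsto_rpow_abs_mul_exp_neg_mul_sq_cocompact (half_pos hc) i).mul_const
    (Real.exp (b ^ 2 / (2 * c)))
  rw [zero_mul] at h
  refine squeeze_zero_norm (fun t => ?_) h
  rw [norm_mul, norm_pow, Real.norm_eq_abs, Real.norm_eq_abs, Real.abs_exp, Real.rpow_natCast,
    mul_assoc, ← Real.exp_add]
  gcongr
  have key : -(c / 2) * t ^ 2 + b ^ 2 / (2 * c) - (b * t - c * t ^ 2) =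
      (c * t - b) ^ 2 / (2 * c) := by
    field_simp
    ring
  have : 0 ≤ (c * t - b) ^ 2 / (2 * c) := by positivity
  linarith

open Filter Topology in
theorem tendsto_bsMonomial_fst {K : ℝ} (r T : ℝ) (hK : 0 < K) (i : ℕ) (a b : ℝ) {y : ℝ}
    (hy : 0 < y) {l : Filter ℝ} (hl : ∀ᶠ x in l, 0 < x)
    (hlog : Tendsto (fun x => Real.log (x / K) + r * T) l (cocompact ℝ)) :
    Tendsto (fun x => bsMonomial K r T i a b x y) l (𝓝 0) := by
  have h := ((tendsto_pow_mul_exp_sub_sq_cocompact i (a - 1 / 2)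
    (c := 1 / (2 * y)) (by positivity)).comp hlog).mul_const
      (y ^ b * Real.exp (a * (Real.log K - r * T) - y / 8))
  rw [zero_mul] at h
  refine h.congr' ?_
  filter_upwards [hl] with x hx
  simp only [bsMonomial, Function.comp, Real.rpow_def_of_pos hx]
  have hlx : Real.log x = Real.log (x / K) + Real.log K := by
    rw [Real.log_div hx.ne' hK.ne']
    ring
  rw [hlx]
  generalize Real.log (x / K) = u
  calc _ = (u + r * T) ^ i * y ^ b * (Real.exp ((a - 1 / 2) * (u + r * T) - 1 / (2 * y) *
        (u + r * T) ^ 2) * Real.exp (a * (Real.log K - r * T) - y / 8)) := by ring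
    _ = (u + r * T) ^ i * y ^ b * (Real.exp ((u + Real.log K) * a) *
        Real.exp (-(u + r * T) ^ 2 / (2 * y) - (u + r * T) / 2 - y / 8)) := by
      rw [← Real.exp_add, ← Real.exp_add]
      congr 2
      ring
    _ = _ := by ring

open Filter Topology in
theorem tendsto_bsMonomial_snd_atTop (K r T : ℝ) (i : ℕ) (a b x : ℝ) :
    Tendsto (fun y => bsMonomial K r T i a b x y) atTop (𝓝 0) := by
  set L := Real.log (x / K) + r * T with hL
  have h := (tendsto_rpow_mul_exp_neg_mul_atTop_nhds_zero b (1 / 8) (by norm_num)).const_mul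
    (|L ^ i * x ^ a| * Real.exp (-L / 2))
  rw [mul_zero] at h
  refine squeeze_zero_norm' ?_ h
  filter_upwards [eventually_gt_atTop 0] with y hy
  simp only [bsMonomial, ← hL]
  have hyb : 0 ≤ y ^ b := by positivity
  rw [Real.norm_eq_abs, abs_mul, abs_mul, abs_of_nonneg hyb, Real.abs_exp]
  calc |L ^ i * x ^ a| * y ^ b * Real.exp (-L ^ 2 / (2 * y) - L / 2 - y / 8)
      ≤ |L ^ i * x ^ a| * y ^ b * Real.exp (-L / 2 + -(1 / 8) * y) := by
        gcongr
        have : 0 ≤ L ^ 2 / (2 * y) := by positivity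
        rw [neg_div]
        linarith
    _ = _ := by
        rw [Real.exp_add]
        ring

open Filter Topology in
theorem tendsto_bsMonomial_snd_zero {K r T x : ℝ} (i : ℕ) (a b : ℝ)
    (hx : Real.log (x / K) + r * T ≠ 0) :
    Tendsto (fun y => bsMonomial K r T i a b x y) (𝓝[>] 0) (𝓝 0) := by
  set L := Real.log (x / K) + r * T with hL
  have h := ((tendsto_rpow_mul_exp_neg_mul_atTop_nhds_zero (-b) (L ^ 2 / 2)
    (by positivity)).comp tendsto_inv_nhdsGT_zero).const_mul
    (|L ^ i * x ^ a| * Real.exp (-L / 2))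
  rw [mul_zero] at h
  refine squeeze_zero_norm' ?_ h
  filter_upwards [self_mem_nhdsWithin] with y hy
  have hy : 0 < y := hy
  simp only [bsMonomial, ← hL, Function.comp]
  have hyb : 0 ≤ y ^ b := by positivity
  rw [Real.norm_eq_abs, abs_mul, abs_mul, abs_of_nonneg hyb, Real.abs_exp,
    Real.inv_rpow hy.le, Real.rpow_neg hy.le, inv_inv]
  calc |L ^ i * x ^ a| * y ^ b * Real.exp (-L ^ 2 / (2 * y) - L / 2 - y / 8)
      ≤ |L ^ i * x ^ a| * y ^ b * Real.exp (-L / 2 + -(L ^ 2 / 2) * y⁻¹) := by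
        gcongr
        have : -L ^ 2 / (2 * y) = -(L ^ 2 / 2) * y⁻¹ := by
          field_simp
        linarith
    _ = _ := by
        rw [Real.exp_add]
        ring

open Filter Topology in
/-- A limit statement along points `u t` holds on `bsSpan` once it holds on the monomials. -/
theorem tendsto_zero_of_mem_bsSpan {K r T : ℝ} {l : Filter ℝ} {u v : ℝ → ℝ}
    (h : ∀ i a b, Tendsto (fun t => bsMonomial K r T i a b (u t) (v t)) l (𝓝 0))
    {f : ℝ → ℝ → ℝ} (hf : f ∈ bsSpan K r T) :
    Tendsto (fun t => f (u t) (v t)) l (𝓝 0) := by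
  induction hf using Submodule.span_induction with
  | mem f hf =>
    obtain ⟨i, a, b, rfl⟩ := hf
    exact h i a b
  | zero => exact tendsto_const_nhds
  | add f₁ f₂ _ _ h₁ h₂ => simpa using h₁.add h₂
  | smul c f _ hf => simpa using hf.const_mul c

open Filter Topology in
/-- Boundary limits of the high-order derivatives of the Black–Scholes put price
(Appendix A): writing `D(x,y)` for the mixed derivative of total order `ξ_x + ξ_y ≥ 3`,
(i) `D(x,y) → 0` as `x → 0⁺` and as `x → ∞` for each fixed `y > 0`;
(ii) `D(x,y) → 0` as `y → ∞` for each fixed `x > 0`;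
(iii) `D(x,y) → 0` as `y → 0⁺` for each fixed `x > 0` with `ln(x/K) + rT ≠ 0`. -/
theorem bsPut_mixed_partial_boundary_limits (K r T : ℝ) (hK : 0 < K) (hT : 0 < T)
    (ξx ξy : ℕ) (hξ : 3 ≤ ξx + ξy) :
    (∀ y : ℝ, 0 < y →
      Tendsto (fun x => mixedPartial (BSPut K r T) ξx ξy x y) (𝓝[>] 0) (𝓝 0) ∧
      Tendsto (fun x => mixedPartial (BSPut K r T) ξx ξy x y) atTop (𝓝 0)) ∧
    (∀ x : ℝ, 0 < x →
      Tendsto (fun y => mixedPartial (BSPut K r T) ξx ξy x y) atTop (𝓝 0)) ∧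
    (∀ x : ℝ, 0 < x → Real.log (x / K) + r * T ≠ 0 →
      Tendsto (fun y => mixedPartial (BSPut K r T) ξx ξy x y) (𝓝[>] 0) (𝓝 0)) := by
  obtain ⟨g, hg, h⟩ := exists_mixedPartial_BSPut_mem_bsSpan r T hK ξx ξy (by omega)
  refine ⟨fun y hy => ⟨?_, ?_⟩, fun x hx => ?_, fun x hx hL => ?_⟩
  · have hpos : ∀ᶠ x : ℝ in 𝓝[>] 0, 0 < x := self_mem_nhdsWithin
    refine Tendsto.congr' (hpos.mono fun x hx => (h x y hx hy).symm) ?_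
    refine tendsto_zero_of_mem_bsSpan (u := fun x => x) (v := fun _ => y) (fun i a b => ?_) hg
    refine tendsto_bsMonomial_fst r T hK i a b hy hpos (Tendsto.mono_right ?_ atBot_le_cocompact)
    refine tendsto_atBot_add_const_right _ _ (Real.tendsto_log_nhdsGT_zero.comp ?_)
    refine tendsto_nhdsWithin_iff.2 ⟨?_, hpos.mono fun x hx => div_pos hx hK⟩
    have hcont : Tendsto (fun x : ℝ => x / K) (𝓝 0) (𝓝 (0 / K)) := tendsto_id.div_const K
    rw [zero_div] at hcont
    exact hcont.mono_left nhdsWithin_le_nhds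
  · have hpos : ∀ᶠ x : ℝ in atTop, 0 < x := eventually_gt_atTop 0
    refine Tendsto.congr' (hpos.mono fun x hx => (h x y hx hy).symm) ?_
    refine tendsto_zero_of_mem_bsSpan (u := fun x => x) (v := fun _ => y) (fun i a b => ?_) hg
    refine tendsto_bsMonomial_fst r T hK i a b hy hpos (Tendsto.mono_right ?_ atTop_le_cocompact)
    exact tendsto_atTop_add_const_right _ _
      (Real.tendsto_log_atTop.comp (tendsto_id.atTop_div_const hK))
  · refine Tendsto.congr' ((eventually_gt_atTop 0).mono fun y hy => (h x y hx hy).symm) ?_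
    exact tendsto_zero_of_mem_bsSpan (u := fun _ => x) (v := fun y => y)
      (fun i a b => tendsto_bsMonomial_snd_atTop K r T i a b x) hg
  · have hpos : ∀ᶠ y : ℝ in 𝓝[>] 0, 0 < y := self_mem_nhdsWithin
    refine Tendsto.congr' (hpos.mono fun y hy => (h x y hx hy).symm) ?_
    exact tendsto_zero_of_mem_bsSpan (u := fun _ => x) (v := fun y => y)
      (fun i a b => tendsto_bsMonomial_snd_zero i a b hL) hg
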